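/- arXiv:2108.09787 — 3 statements merged into one kernel-verified Lean document; each statement's English description precedes it below -/
import Mathlib

section
/- Let M be a Malcev algebra over k, V a k-vector space, and let an extending datum (⊲,▷,ω,{·,·}) be given such that the unified product bracket on M⊕V is a Malcev algebra bracket. Then for all u,p,v,q ∈ V: {{u,p},{v,q}} + ω(u,p)▷{v,q} − ω(v,q)▷{u,p} = {{{u,v},p}, q} + {ω(u,v)▷p, q} + (ω(u,v)⊲p)▷q + ω({u,v},p)▷q + {{{v,p},q}, u} + {ω(v,p)▷q, u} + (ω(v,p)⊲q)▷u + ω({v,p},q)▷u + {{{p,q},u}, v} + {ω(p,q)▷u, v} + (ω(p,q)⊲u)▷v + ω({p,q},u)▷v + {{{q,u},v}, p} + {ω(q,u)▷v, p} + (ω(q,u)⊲v)▷p + ω({q,u},v)▷p. -/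
def IsBilin (k : Type*) [Field k] {A B C : Type*}
    [AddCommGroup A] [Module k A] [AddCommGroup B] [Module k B]
    [AddCommGroup C] [Module k C] (f : A → B → C) : Prop :=
  (∀ (x y : A) (z : B), f (x + y) z = f x z + f y z) ∧
  (∀ (c : k) (x : A) (z : B), f (c • x) z = c • f x z) ∧
  (∀ (x : A) (y z : B), f x (y + z) = f x y + f x z) ∧
  (∀ (c : k) (x : A) (z : B), f x (c • z) = c • f x z)

def jacF {A : Type*} [AddCommGroup A] (br : A → A → A) (x y z : A) : A :=
  br (br x y) z + br (br y z) x + br (br z x) y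

def IsMalcevBracket (k : Type*) [Field k] {A : Type*} [AddCommGroup A] [Module k A]
    (br : A → A → A) : Prop :=
  IsBilin k br ∧ (∀ x y : A, br x y = - br y x) ∧
  (∀ x y z : A, jacF br x y (br x z) = br (jacF br x y z) x)

def ubr {M V : Type*} [AddCommGroup M] [AddCommGroup V]
    (bm : M → M → M) (tl : M → V → M) (tr : M → V → V)
    (om : V → V → M) (bv : V → V → V) :
    M × V → M × V → M × V :=
  fun p q =>
    (bm p.1 q.1 + tl p.1 q.2 - tl q.1 p.2 + om p.2 q.2,
     tr p.1 q.2 - tr q.1 p.2 + bv p.2 q.2)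

/-- The linearization, in the repeated variable, of the Malcev identity. -/
lemma IsMalcevBracket.jacF_add_jacF {k : Type*} [Field k] {A : Type*} [AddCommGroup A]
    [Module k A] {br : A → A → A} (h : IsMalcevBracket k br) (x w y z : A) :
    jacF br x y (br w z) + jacF br w y (br x z) =
      br (jacF br x y z) w + br (jacF br w y z) x := by
  obtain ⟨⟨add_left, -, add_right, -⟩, -, malcev⟩ := h
  have hxw := malcev (x + w) y z
  have hx := malcev x y z
  have hw := malcev w y z
  simp only [jacF, add_left, add_right] at hxw hx hw ⊢
  linear_combination (norm := module) hxw - hx - hw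

/-- The Sagle identity, valid in every Malcev algebra of characteristic different from two. -/
lemma IsMalcevBracket.sagle {k : Type*} [Field k] (h2 : (2 : k) ≠ 0) {A : Type*}
    [AddCommGroup A] [Module k A] {br : A → A → A} (h : IsMalcevBracket k br) (x y z t : A) :
    br (br x z) (br y t) =
      br (br (br x y) z) t + br (br (br y z) t) x + br (br (br z t) x) y
        + br (br (br t x) y) z := by
  have hxy := h.jacF_add_jacF x y z t
  have hxz := h.jacF_add_jacF x z t y
  have htx := h.jacF_add_jacF t x y z
  obtain ⟨⟨add_left, smul_left, -, smul_right⟩, anti, -⟩ := h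
  have neg_left (a b : A) : br (-a) b = -br a b := by simpa using smul_left (-1) a b
  have neg_right (a b : A) : br a (-b) = -br a b := by simpa using smul_right (-1) a b
  apply smul_right_injective A h2
  simp only [jacF, add_left, anti y x, anti z x, anti t x, anti z y, anti t y,
    anti t z, anti y (br _ _), anti z (br _ _), anti t (br _ _),
    anti (br z t) (br x y), anti (br y t) (br x z), anti (br y z) (br x t),
    neg_left, neg_right] at hxy hxz htx ⊢
  linear_combination (norm := module) hxy - hxz + htx

theorem stmt10 {k : Type*} [Field k] (h2 : (2 : k) ≠ 0) (h3 : (3 : k) ≠ 0) {M V : Type*} [AddCommGroup M] [Module k M] [AddCommGroup V] [Module k V]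
    (bm : M → M → M) (hbm : IsMalcevBracket k bm)
    (tl : M → V → M) (htl : IsBilin k tl)
    (tr : M → V → V) (htr : IsBilin k tr)
    (om : V → V → M) (hom : IsBilin k om) (homa : ∀ u v : V, om u v = - om v u)
    (bv : V → V → V) (hbv : IsBilin k bv) (hbva : ∀ u v : V, bv u v = - bv v u)
    (huni : IsMalcevBracket k (ubr bm tl tr om bv)) :
    ∀ (u p v q : V),
      bv (bv u p) (bv v q) + tr (om u p) (bv v q) - tr (om v q) (bv u p) =
      bv (bv (bv u v) p) q + bv (tr (om u v) p) q + tr (tl (om u v) p) q + tr (om (bv u v) p) q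
      + bv (bv (bv v p) q) u + bv (tr (om v p) q) u + tr (tl (om v p) q) u + tr (om (bv v p) q) u
      + bv (bv (bv p q) u) v + bv (tr (om p q) u) v + tr (tl (om p q) u) v + tr (om (bv p q) u) v
      + bv (bv (bv q u) v) p + bv (tr (om q u) v) p + tr (tl (om q u) v) p + tr (om (bv q u) v) p := by
  intro u p v q
  have sagle := congrArg Prod.snd (huni.sagle h2 (0, u) (0, v) (0, p) (0, q))
  have bm_zero_left (b : M) : bm 0 b = 0 := by simpa using hbm.1.2.1 0 0 b
  have bm_zero_right (a : M) : bm a 0 = 0 := by simpa using hbm.1.2.2.2 0 a 0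
  have tl_zero_left (b : V) : tl 0 b = 0 := by simpa using htl.2.1 0 0 b
  have tr_zero_left (b : V) : tr 0 b = 0 := by simpa using htr.2.1 0 0 b
  simp only [ubr, Prod.snd_add, bm_zero_left, bm_zero_right, tl_zero_left, tr_zero_left,
    zero_add, sub_zero, htr.1, hbv.1] at sagle
  linear_combination (norm := module) sagle
end

section
/- Let M be a Malcev algebra over k and V a k-vector space; set E = M⊕V. Let T(M,V) be the set of extending data Ω = (⊲,▷,ω,{·,·}) whose unified product bracket makes E a Malcev algebra. Declare Ω ≡ Ω' if there exist a linear map r : V→M and a bijective linear map s : V→V such that for all x ∈ M, u,v ∈ V: s(x▷v) = x▷'s(v); x⊲v + r(x▷v) = [x, r(v)] + x⊲'s(v); s({u,v}) = {s(u),s(v)}' + r(u)▷'s(v) − r(v)▷'s(u); and ω(u,v) + r({u,v}) = [r(u), r(v)] + r(u)⊲'s(v) − r(v)⊲'s(u) + ω'(s(u),s(v)); declare Ω ≈ Ω' if such a pair exists with s = id_V. Let Extd(E,M) denote the set of Malcev algebra brackets on E that restrict on M×M to the given bracket of M, modulo the relation identifying two brackets when there is a Malcev algebra isomorphism between them that fixes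 M pointwise; let Extd'(E,M) be the same set modulo isomorphisms that fix M pointwise and additionally commute with the projection E→V along M. Then the assignment Ω ↦ (unified product bracket of Ω) induces well-defined bijections T(M,V)/≡ → Extd(E,M) and T(M,V)/≈ → Extd'(E,M). -/
structure ExtDatum (k : Type*) [Field k] (M V : Type*)
    [AddCommGroup M] [Module k M] [AddCommGroup V] [Module k V] where
  tl : M → V → M
  tr : M → V → V
  om : V → V → M
  bv : V → V → V
  tl_bil : IsBilin k tl
  tr_bil : IsBilin k tr
  om_bil : IsBilin k om
  bv_bil : IsBilin k bv
  om_anti : ∀ u v : V, om u v = - om v u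
  bv_anti : ∀ u v : V, bv u v = - bv v u

theorem IsBilin.zero_right {k : Type*} [Field k] {A B C : Type*}
    [AddCommGroup A] [Module k A] [AddCommGroup B] [Module k B]
    [AddCommGroup C] [Module k C] {f : A → B → C} (h : IsBilin k f) (x : A) :
    f x 0 = 0 := by
  have := h.2.2.2 (0 : k) x 0
  simpa using this

/-- The set of extending data whose unified product is a Malcev bracket. -/
def TMV (k : Type*) [Field k] (M V : Type*)
    [AddCommGroup M] [Module k M] [AddCommGroup V] [Module k V]
    (bm : M → M → M) : Type _ :=
  {Ω : ExtDatum k M V // IsMalcevBracket k (ubr bm Ω.tl Ω.tr Ω.om Ω.bv)}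

/-- The compatibility conditions between two extending data, relative to maps `r`, `s`. -/
def datumRel (k : Type*) [Field k] {M V : Type*}
    [AddCommGroup M] [Module k M] [AddCommGroup V] [Module k V]
    (bm : M → M → M) (Ω Ω' : ExtDatum k M V) (r : V →ₗ[k] M) (s : V →ₗ[k] V) : Prop :=
  (∀ (x : M) (v : V), s (Ω.tr x v) = Ω'.tr x (s v)) ∧
  (∀ (x : M) (v : V), Ω.tl x v + r (Ω.tr x v) = bm x (r v) + Ω'.tl x (s v)) ∧
  (∀ u v : V, s (Ω.bv u v) = Ω'.bv (s u) (s v) + Ω'.tr (r u) (s v) - Ω'.tr (r v) (s u)) ∧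
  (∀ u v : V, Ω.om u v + r (Ω.bv u v) =
    bm (r u) (r v) + Ω'.tl (r u) (s v) - Ω'.tl (r v) (s u) + Ω'.om (s u) (s v))

def req (k : Type*) [Field k] {M V : Type*}
    [AddCommGroup M] [Module k M] [AddCommGroup V] [Module k V]
    (bm : M → M → M) (Ω Ω' : TMV k M V bm) : Prop :=
  ∃ (r : V →ₗ[k] M) (s : V →ₗ[k] V), Function.Bijective s ∧ datumRel k bm Ω.1 Ω'.1 r s

def rapp (k : Type*) [Field k] {M V : Type*}
    [AddCommGroup M] [Module k M] [AddCommGroup V] [Module k V]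
    (bm : M → M → M) (Ω Ω' : TMV k M V bm) : Prop :=
  ∃ r : V →ₗ[k] M, datumRel k bm Ω.1 Ω'.1 r LinearMap.id

/-- Malcev brackets on `M × V` restricting to the given bracket on `M`. -/
def GoodBr (k : Type*) [Field k] (M V : Type*)
    [AddCommGroup M] [Module k M] [AddCommGroup V] [Module k V]
    (bm : M → M → M) : Type _ :=
  {br : (M × V) → (M × V) → (M × V) //
    IsMalcevBracket k br ∧ ∀ x y : M, br (x, (0 : V)) (y, (0 : V)) = (bm x y, (0 : V))}

def brEquiv (k : Type*) [Field k] {M V : Type*}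
    [AddCommGroup M] [Module k M] [AddCommGroup V] [Module k V]
    (bm : M → M → M) (b b' : GoodBr k M V bm) : Prop :=
  ∃ φ : (M × V) →ₗ[k] (M × V), Function.Bijective φ ∧
    (∀ p q : M × V, φ (b.1 p q) = b'.1 (φ p) (φ q)) ∧
    (∀ x : M, φ (x, (0 : V)) = (x, (0 : V)))

def brEquiv' (k : Type*) [Field k] {M V : Type*}
    [AddCommGroup M] [Module k M] [AddCommGroup V] [Module k V]
    (bm : M → M → M) (b b' : GoodBr k M V bm) : Prop :=
  ∃ φ : (M × V) →ₗ[k] (M × V), Function.Bijective φ ∧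
    (∀ p q : M × V, φ (b.1 p q) = b'.1 (φ p) (φ q)) ∧
    (∀ x : M, φ (x, (0 : V)) = (x, (0 : V))) ∧
    (∀ p : M × V, (φ p).2 = p.2)

theorem ubr_restrict {k : Type*} [Field k] {M V : Type*}
    [AddCommGroup M] [Module k M] [AddCommGroup V] [Module k V]
    (bm : M → M → M) (Ω : ExtDatum k M V) (x y : M) :
    ubr bm Ω.tl Ω.tr Ω.om Ω.bv (x, (0 : V)) (y, (0 : V)) = (bm x y, (0 : V)) := by
  simp [ubr, Ω.tl_bil.zero_right, Ω.tr_bil.zero_right,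
    Ω.om_bil.zero_right, Ω.bv_bil.zero_right]

namespace IsBilin

variable {k A B C : Type*} [Field k] [AddCommGroup A] [Module k A] [AddCommGroup B] [Module k B]
  [AddCommGroup C] [Module k C] {f : A → B → C}

theorem zero_left (h : IsBilin k f) (y : B) : f 0 y = 0 := by
  simpa using h.2.1 (0 : k) 0 y

/-- A bilinear map precomposed with linear maps and postcomposed with a linear map is bilinear. -/
theorem comp {A' B' C' : Type*} [AddCommGroup A'] [Module k A'] [AddCommGroup B'] [Module k B']
    [AddCommGroup C'] [Module k C'] (h : IsBilin k f)
    (a : A' →ₗ[k] A) (b : B' →ₗ[k] B) (c : C →ₗ[k] C') :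
    IsBilin k (fun x y => c (f (a x) (b y))) := by
  obtain ⟨hadd, hsmul, hadd', hsmul'⟩ := h
  refine ⟨?_, ?_, ?_, ?_⟩ <;> intros <;> simp [hadd, hsmul, hadd', hsmul']

end IsBilin

section UnifiedProduct

variable {k M V : Type*} [Field k] [AddCommGroup M] [Module k M] [AddCommGroup V] [Module k V]
  {bm : M → M → M}

/-- The linear endomorphism `(x, u) ↦ (x + r u, s u)` of `M × V`. -/
def shearMap (r : V →ₗ[k] M) (s : V →ₗ[k] V) : M × V →ₗ[k] M × V :=
  (LinearMap.fst k M V + r ∘ₗ LinearMap.snd k M V).prod (s ∘ₗ LinearMap.snd k M V)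

@[simp]
theorem shearMap_apply (r : V →ₗ[k] M) (s : V →ₗ[k] V) (p : M × V) :
    shearMap r s p = (p.1 + r p.2, s p.2) := rfl

theorem shearMap_bijective_iff (r : V →ₗ[k] M) (s : V →ₗ[k] V) :
    Function.Bijective (shearMap r s) ↔ Function.Bijective s := by
  constructor
  · rintro ⟨hinj, hsurj⟩
    refine ⟨fun u v huv => ?_, fun v => ?_⟩
    · have h : ((-r u, u) : M × V) = (-r v, v) := hinj (by simp [huv])
      exact congrArg Prod.snd h
    · obtain ⟨p, hp⟩ := hsurj (0, v)
      exact ⟨p.2, congrArg Prod.snd hp⟩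
  · rintro ⟨hinj, hsurj⟩
    refine ⟨fun p q hpq => ?_, fun q => ?_⟩
    · simp only [shearMap_apply, Prod.mk.injEq] at hpq
      have h : p.2 = q.2 := hinj hpq.2
      exact Prod.ext (by simpa [h] using hpq.1) h
    · obtain ⟨v, hv⟩ := hsurj q.2
      exact ⟨(q.1 - r v, v), by simp [hv]⟩

/-- A linear endomorphism of `M × V` fixing `M` pointwise is a shear map. -/
theorem exists_eq_shearMap (φ : M × V →ₗ[k] M × V)
    (hφ : ∀ x : M, φ (x, (0 : V)) = (x, (0 : V))) :
    ∃ (r : V →ₗ[k] M) (s : V →ₗ[k] V), φ = shearMap r s := by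
  refine ⟨LinearMap.fst k M V ∘ₗ φ ∘ₗ LinearMap.inr k M V,
    LinearMap.snd k M V ∘ₗ φ ∘ₗ LinearMap.inr k M V, LinearMap.ext fun p => ?_⟩
  have h : φ p = (p.1, 0) + φ (0, p.2) := by
    rw [← hφ, ← map_add]
    simp
  rw [h]
  ext <;> simp

/-- A shear map is a morphism of unified products exactly when it relates the extending data. -/
theorem shearMap_ubr_iff_datumRel (hbm : IsMalcevBracket k bm) (Ω Ω' : ExtDatum k M V)
    (r : V →ₗ[k] M) (s : V →ₗ[k] V) :
    (∀ p q : M × V, shearMap r s (ubr bm Ω.tl Ω.tr Ω.om Ω.bv p q) =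
        ubr bm Ω'.tl Ω'.tr Ω'.om Ω'.bv (shearMap r s p) (shearMap r s q)) ↔
      datumRel k bm Ω Ω' r s := by
  constructor
  · intro h
    have hMV (x : M) (v : V) := h (x, 0) (0, v)
    have hVV (u v : V) := h (0, u) (0, v)
    simp only [ubr, shearMap_apply, Prod.mk.injEq, map_zero, add_zero, zero_add, sub_zero,
      hbm.1.zero_right, Ω.tl_bil.zero_right, Ω.tr_bil.zero_right,
      Ω.tl_bil.zero_left, Ω.tr_bil.zero_left, Ω.om_bil.zero_left, Ω.bv_bil.zero_left,
      Ω'.tl_bil.zero_right, Ω'.tr_bil.zero_right,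
      Ω'.om_bil.zero_left, Ω'.bv_bil.zero_left] at hMV hVV
    refine ⟨fun x v => (hMV x v).2, fun x v => (hMV x v).1, fun u v => ?_,
      fun u v => (hVV u v).1⟩
    rw [(hVV u v).2]
    abel
  · rintro ⟨htr, htl, hbv, hom⟩ ⟨x, u⟩ ⟨y, v⟩
    simp only [ubr, shearMap_apply, Prod.mk.injEq, map_add, map_sub, hbm.1.1, hbm.1.2.2.1,
      Ω'.tl_bil.1, Ω'.tr_bil.1, htr, hbv]
    refine ⟨?_, by abel⟩
    have hxv := htl x v
    have hyu := htl y u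
    have huv := hom u v
    rw [← eq_sub_iff_add_eq] at hxv hyu huv
    rw [hxv, hyu, huv, hbm.2.1 (r u) y]
    abel

/-- The extending datum read off from a Malcev bracket on `M × V`. -/
def ExtDatum.ofBracket {br : M × V → M × V → M × V} (h : IsMalcevBracket k br) :
    ExtDatum k M V where
  tl x v := (br (x, 0) (0, v)).1
  tr x v := (br (x, 0) (0, v)).2
  om u v := (br (0, u) (0, v)).1
  bv u v := (br (0, u) (0, v)).2
  tl_bil := h.1.comp (LinearMap.inl k M V) (LinearMap.inr k M V) (LinearMap.fst k M V)
  tr_bil := h.1.comp (LinearMap.inl k M V) (LinearMap.inr k M V) (LinearMap.snd k M V)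
  om_bil := h.1.comp (LinearMap.inr k M V) (LinearMap.inr k M V) (LinearMap.fst k M V)
  bv_bil := h.1.comp (LinearMap.inr k M V) (LinearMap.inr k M V) (LinearMap.snd k M V)
  om_anti u v := congrArg Prod.fst (h.2.1 (0, u) (0, v))
  bv_anti u v := congrArg Prod.snd (h.2.1 (0, u) (0, v))

theorem ubr_ofBracket {br : M × V → M × V → M × V} (h : IsMalcevBracket k br)
    (hres : ∀ x y : M, br (x, (0 : V)) (y, (0 : V)) = (bm x y, (0 : V))) :
    ubr bm (ExtDatum.ofBracket h).tl (ExtDatum.ofBracket h).tr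
      (ExtDatum.ofBracket h).om (ExtDatum.ofBracket h).bv = br := by
  funext ⟨x, u⟩ ⟨y, v⟩
  have hsplit : br (x, u) (y, v) =
      br (x, 0) (y, 0) + br (x, 0) (0, v) - br (y, 0) (0, u) + br (0, u) (0, v) := by
    have hx : ((x, u) : M × V) = (x, 0) + (0, u) := by simp
    have hy : ((y, v) : M × V) = (y, 0) + (0, v) := by simp
    rw [hx, hy, h.1.1, h.1.2.2.1, h.1.2.2.1, h.2.1 (0, u) (y, 0)]
    abel
  rw [hsplit, hres]
  ext <;> simp [ubr, ExtDatum.ofBracket]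

theorem ofBracket_ubr (hbm : IsMalcevBracket k bm) (Ω : ExtDatum k M V)
    (h : IsMalcevBracket k (ubr bm Ω.tl Ω.tr Ω.om Ω.bv)) : ExtDatum.ofBracket h = Ω := by
  obtain ⟨tl, tr, om, bv, htl, htr, hom, hbv, _, _⟩ := Ω
  simp [ExtDatum.ofBracket, ubr, hbm.1.zero_right, htl.zero_left, htr.zero_left,
    hom.zero_left, hbv.zero_left]

/-- Extending data with Malcev unified product correspond to Malcev brackets on `M × V`
extending the bracket of `M`. -/
def unifiedProductEquiv (hbm : IsMalcevBracket k bm) : TMV k M V bm ≃ GoodBr k M V bm where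
  toFun Ω := ⟨ubr bm Ω.1.tl Ω.1.tr Ω.1.om Ω.1.bv, Ω.2, fun x y => ubr_restrict bm Ω.1 x y⟩
  invFun b := ⟨ExtDatum.ofBracket b.2.1, by rw [ubr_ofBracket b.2.1 b.2.2]; exact b.2.1⟩
  left_inv Ω := Subtype.ext (ofBracket_ubr hbm Ω.1 Ω.2)
  right_inv b := Subtype.ext (ubr_ofBracket b.2.1 b.2.2)

theorem req_iff_brEquiv (hbm : IsMalcevBracket k bm) (Ω Ω' : TMV k M V bm) :
    req k bm Ω Ω' ↔
      brEquiv k bm (unifiedProductEquiv hbm Ω) (unifiedProductEquiv hbm Ω') := by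
  constructor
  · rintro ⟨r, s, hs, hrel⟩
    exact ⟨shearMap r s, (shearMap_bijective_iff r s).2 hs,
      (shearMap_ubr_iff_datumRel hbm Ω.1 Ω'.1 r s).2 hrel, fun x => by simp⟩
  · rintro ⟨φ, hbij, hmul, hfix⟩
    obtain ⟨r, s, rfl⟩ := exists_eq_shearMap φ hfix
    exact ⟨r, s, (shearMap_bijective_iff r s).1 hbij,
      (shearMap_ubr_iff_datumRel hbm Ω.1 Ω'.1 r s).1 hmul⟩

theorem rapp_iff_brEquiv' (hbm : IsMalcevBracket k bm) (Ω Ω' : TMV k M V bm) :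
    rapp k bm Ω Ω' ↔
      brEquiv' k bm (unifiedProductEquiv hbm Ω) (unifiedProductEquiv hbm Ω') := by
  constructor
  · rintro ⟨r, hrel⟩
    exact ⟨shearMap r LinearMap.id, (shearMap_bijective_iff r _).2 Function.bijective_id,
      (shearMap_ubr_iff_datumRel hbm Ω.1 Ω'.1 r _).2 hrel, fun x => by simp, fun p => by simp⟩
  · rintro ⟨φ, -, hmul, hfix, hproj⟩
    obtain ⟨r, s, rfl⟩ := exists_eq_shearMap φ hfix
    obtain rfl : s = LinearMap.id := LinearMap.ext fun v => hproj (0, v)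
    exact ⟨r, (shearMap_ubr_iff_datumRel hbm Ω.1 Ω'.1 r _).1 hmul⟩

end UnifiedProduct

theorem stmt16 {k : Type*} [Field k] (h2 : (2 : k) ≠ 0) (h3 : (3 : k) ≠ 0) {M V : Type*} [AddCommGroup M] [Module k M] [AddCommGroup V] [Module k V]
    (bm : M → M → M) (hbm : IsMalcevBracket k bm) :
    (∃ F : Quot (req k bm) → Quot (brEquiv k bm),
      Function.Bijective F ∧
      ∀ Ω : TMV k M V bm,
        F (Quot.mk _ Ω) =
          Quot.mk _ (⟨ubr bm Ω.1.tl Ω.1.tr Ω.1.om Ω.1.bv,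
            Ω.2, fun x y => ubr_restrict bm Ω.1 x y⟩ : GoodBr k M V bm)) ∧
    (∃ F' : Quot (rapp k bm) → Quot (brEquiv' k bm),
      Function.Bijective F' ∧
      ∀ Ω : TMV k M V bm,
        F' (Quot.mk _ Ω) =
          Quot.mk _ (⟨ubr bm Ω.1.tl Ω.1.tr Ω.1.om Ω.1.bv,
            Ω.2, fun x y => ubr_restrict bm Ω.1 x y⟩ : GoodBr k M V bm)) := by
  exact ⟨⟨Quot.congr (unifiedProductEquiv hbm) (req_iff_brEquiv hbm),
      Equiv.bijective _, fun _ => rfl⟩,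
    ⟨Quot.congr (unifiedProductEquiv hbm) (rapp_iff_brEquiv' hbm),
      Equiv.bijective _, fun _ => rfl⟩⟩
end

section
/- Let M be a Malcev algebra over k (char k ∉ {2,3}) and let λ : M→k and D : M→M be linear maps. Define an antisymmetric bracket on M⊕k by [(x,a),(y,b)] = ([x,y] + bD(x) − aD(y), bλ(x) − aλ(y)). Then M⊕k with this bracket is a Malcev algebra if and only if for all x,y,z ∈ M: (T1) [[x,z],D(y)] + λ(y)D([x,z]) = D([[x,y],z]) + [D([y,z]),x] − λ([y,z])D(x) + [[D(z),x],y] − λ(z)[D(x),y] + λ(x)λ(z)D(y) − [[D(x),y],z] + λ(x)[D(y),z] − λ(x)λ(y)D(z); (T2) λ(D(y))D(x) − λ(x)D(D(y)) + D([D(x),y]) − [D(D(y)),x] + λ(y)D(D(x)) − D(D([x,y])) + [D(x),D(y)] − λ(x)D(D(y)) = 0; (T3) λ(D([x,y])) − λ(D(x))λ(y) − λ([D(x),y]) + λ(x)λ(D(y)) = 0; (T4) D([D(x),y]) − λ(x)D(D(y)) − [D(D(y)),x] + λ(D(y))D(x) + D([D(y),x]) − λ(y)D(D(x)) − [D(D(x)),y]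 + λ(D(x))D(y) = 0; (T5) λ([D(x),y]) + λ([D(y),x]) = 0; (T6) λ([x,z])λ(y) = λ([[x,y],z]) − λ(x)λ([y,z]). -/
/-- The defect of Sagle's identity
`[[x,z],[y,t]] = [[[x,y],z],t] + [[[y,z],t],x] + [[[z,t],x],y] + [[[t,x],y],z]`. -/
def sagleF {A : Type*} [AddCommGroup A] (br : A → A → A) (x y z t : A) : A :=
  br (br x z) (br y t) - (br (br (br x y) z) t + br (br (br y z) t) x
    + br (br (br z t) x) y + br (br (br t x) y) z)

namespace IsBilin

variable {k : Type*} [Field k] {A B C : Type*} [AddCommGroup A] [Module k A]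
  [AddCommGroup B] [Module k B] [AddCommGroup C] [Module k C] {f : A → B → C}

theorem map_neg_left (hf : IsBilin k f) (x : A) (z : B) : f (-x) z = -f x z := by
  simpa using hf.2.1 (-1) x z

theorem map_neg_right (hf : IsBilin k f) (x : A) (z : B) : f x (-z) = -f x z := by
  simpa using hf.2.2.2 (-1) x z

theorem map_sub_left (hf : IsBilin k f) (x y : A) (z : B) : f (x - y) z = f x z - f y z := by
  rw [sub_eq_add_neg, hf.1, hf.map_neg_left, sub_eq_add_neg]

theorem map_sub_right (hf : IsBilin k f) (x : A) (y z : B) : f x (y - z) = f x y - f x z := by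
  rw [sub_eq_add_neg, hf.2.2.1, hf.map_neg_right, sub_eq_add_neg]

theorem map_zero_left (hf : IsBilin k f) (z : B) : f 0 z = 0 := by
  simpa using hf.2.1 0 0 z

theorem map_zero_right (hf : IsBilin k f) (x : A) : f x 0 = 0 := by
  simpa using hf.2.2.2 0 x 0

end IsBilin

section Sagle

variable {k : Type*} [Field k] {A : Type*} [AddCommGroup A] [Module k A] {br : A → A → A}

theorem sagleF_rotate (hb : IsBilin k br) (ha : ∀ x y, br x y = -br y x) (x y z t : A) :
    sagleF br y z t x = sagleF br x y z t := by
  have h : br (br y t) (br z x) = br (br x z) (br y t) := by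
    rw [ha (br y t), ha z x, hb.map_neg_left, neg_neg]
  simp only [sagleF, h]
  abel

theorem sagleF_self (hb : IsBilin k br) (ha : ∀ x y, br x y = -br y x) (h2 : (2 : k) ≠ 0)
    (x y z : A) :
    sagleF br x x y z = jacF br x y (br x z) - br (jacF br x y z) x := by
  have h0 : br x x = 0 := by
    have h : (2 : k) • br x x = 0 := by
      rw [two_smul]
      nth_rewrite 1 [ha x x]
      exact neg_add_cancel _
    exact (smul_eq_zero.mp h).resolve_left h2
  have e1 : br (br z x) x = -br (br x z) x := by rw [ha z x, hb.map_neg_left]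
  have e2 : br (br z x) y = -br (br x z) y := by rw [ha z x, hb.map_neg_left]
  have e3 : br y (br x z) = -br (br x z) y := ha _ _
  simp only [sagleF, jacF, h0, e1, e2, e3, hb.1, hb.map_neg_left, hb.map_zero_left]
  abel

theorem sagleF_add_left (hb : IsBilin k br) (x x' y z t : A) :
    sagleF br (x + x') y z t = sagleF br x y z t + sagleF br x' y z t := by
  simp only [sagleF, hb.1, hb.2.2.1]
  abel

theorem sagleF_add_second (hb : IsBilin k br) (x y y' z t : A) :
    sagleF br x (y + y') z t = sagleF br x y z t + sagleF br x y' z t := by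
  simp only [sagleF, hb.1, hb.2.2.1]
  abel

theorem isMalcevBracket_iff_sagleF (h2 : (2 : k) ≠ 0) (hb : IsBilin k br)
    (ha : ∀ x y, br x y = -br y x) :
    IsMalcevBracket k br ↔ ∀ x y z t, sagleF br x y z t = 0 := by
  constructor
  · rintro ⟨-, -, hm⟩ x y z t
    have hself (x z t : A) : sagleF br x x z t = 0 := by
      rw [sagleF_self hb ha h2, hm, sub_self]
    have hswap (x y z t : A) : sagleF br y x z t = -sagleF br x y z t := by
      have h := hself (x + y) z t
      simp only [sagleF_add_left hb, sagleF_add_second hb, hself] at h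
      rw [eq_neg_iff_add_eq_zero]
      simpa [add_comm] using h
    have hrot := sagleF_rotate hb ha
    have hswap' (x y z t : A) : sagleF br x z y t = -sagleF br x y z t := by
      rw [← hrot x z y t, hswap, hrot]
    have hswap'' (x y z t : A) : sagleF br x y t z = -sagleF br x y z t := by
      rw [← hrot x y t z, hswap', hrot]
    have h : sagleF br x y z t = -sagleF br x y z t := by
      nth_rewrite 1 [← hrot]
      rw [hswap'', hswap', hswap, neg_neg]
    have h' : (2 : k) • sagleF br x y z t = 0 := by
      rw [two_smul]
      nth_rewrite 1 [h]
      exact neg_add_cancel _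
    exact (smul_eq_zero.mp h').resolve_left h2
  · intro h
    refine ⟨hb, ha, fun x y z => ?_⟩
    have := h x x y z
    rwa [sagleF_self hb ha h2, sub_eq_zero] at this

end Sagle

section FlagBracket

variable {k : Type*} [Field k] {M : Type*} [AddCommGroup M] [Module k M]

/-- The bracket on `M × k` determined by a bracket on `M` and the pair `(lam, D)`. -/
def flagBracket (bm : M → M → M) (lam : M →ₗ[k] k) (D : M →ₗ[k] M) (p q : M × k) : M × k :=
  (bm p.1 q.1 + q.2 • D p.1 - p.2 • D q.1, q.2 * lam p.1 - p.2 * lam q.1)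

theorem isBilin_flagBracket {bm : M → M → M} (hb : IsBilin k bm) (lam : M →ₗ[k] k)
    (D : M →ₗ[k] M) : IsBilin k (flagBracket bm lam D) := by
  obtain ⟨hal, hsl, har, hsr⟩ := hb
  refine ⟨fun x y z => ?_, fun c x z => ?_, fun x y z => ?_, fun c x z => ?_⟩ <;>
  · ext
    · simp only [flagBracket, Prod.fst_add, Prod.snd_add, Prod.smul_fst, Prod.smul_snd,
        hal, hsl, har, hsr, map_add, map_smul, smul_eq_mul]
      module
    · simp only [flagBracket, Prod.fst_add, Prod.snd_add, Prod.smul_fst, Prod.smul_snd,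
        map_add, map_smul, smul_eq_mul]
      ring

theorem flagBracket_antisymm {bm : M → M → M} (ha : ∀ x y, bm x y = -bm y x)
    (lam : M →ₗ[k] k) (D : M →ₗ[k] M) (p q : M × k) :
    flagBracket bm lam D p q = -flagBracket bm lam D q p := by
  ext
  · simp only [flagBracket, Prod.fst_neg, ha p.1 q.1]
    abel
  · simp only [flagBracket, Prod.snd_neg]
    ring

end FlagBracket

theorem stmt17 {k : Type*} [Field k] (h2 : (2 : k) ≠ 0) (h3 : (3 : k) ≠ 0) {M : Type*} [AddCommGroup M] [Module k M]
    (bm : M → M → M) (hbm : IsMalcevBracket k bm)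
    (lam : M →ₗ[k] k) (D : M →ₗ[k] M) :
    IsMalcevBracket k
      (fun p q : M × k =>
        (bm p.1 q.1 + q.2 • D p.1 - p.2 • D q.1, q.2 * lam p.1 - p.2 * lam q.1)) ↔
    ((∀ x y z : M,
        bm (bm x z) (D y) + lam y • D (bm x z) =
          D (bm (bm x y) z) + bm (D (bm y z)) x - lam (bm y z) • D x
          + bm (bm (D z) x) y - lam z • bm (D x) y + (lam x * lam z) • D y
          - bm (bm (D x) y) z + lam x • bm (D y) z - (lam x * lam y) • D z) ∧
     (∀ x y : M,
        lam (D y) • D x - lam x • D (D y) + D (bm (D x) y) - bm (D (D y)) x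
          + lam y • D (D x) - D (D (bm x y)) + bm (D x) (D y) - lam x • D (D y) = 0) ∧
     (∀ x y : M,
        lam (D (bm x y)) - lam (D x) * lam y - lam (bm (D x) y) + lam x * lam (D y) = 0) ∧
     (∀ x y : M,
        D (bm (D x) y) - lam x • D (D y) - bm (D (D y)) x + lam (D y) • D x
          + D (bm (D y) x) - lam y • D (D x) - bm (D (D x)) y + lam (D x) • D y = 0) ∧
     (∀ x y : M, lam (bm (D x) y) + lam (bm (D y) x) = 0) ∧
     (∀ x y z : M,
        lam (bm x z) * lam y = lam (bm (bm x y) z) - lam x * lam (bm y z))) := by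
  obtain ⟨hb, ha, hm⟩ := hbm
  have hS := (isMalcevBracket_iff_sagleF h2 hb ha).1 ⟨hb, ha, hm⟩
  change IsMalcevBracket k (flagBracket bm lam D) ↔ _
  rw [isMalcevBracket_iff_sagleF h2 (isBilin_flagBracket hb lam D)
    (flagBracket_antisymm ha lam D)]
  have ⟨hal, hsl, har, hsr⟩ := hb
  constructor
  · intro h
    have hxyz (x y z : M) := Prod.ext_iff.1 (h (x, 0) (y, 0) (z, 0) (0, 1))
    have hadj (x y : M) := Prod.ext_iff.1 (h (x, 0) (y, 0) (0, 1) (0, 1))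
    have hopp (x y : M) := Prod.ext_iff.1 (h (x, 0) (0, 1) (y, 0) (0, 1))
    simp only [sagleF, flagBracket, Prod.fst_add, Prod.snd_add, Prod.fst_sub, Prod.snd_sub,
      Prod.fst_zero, Prod.snd_zero, hsl, hb.map_sub_left,
      hb.map_zero_left, hb.map_zero_right, map_sub, map_smul, map_zero, smul_eq_mul,
      zero_smul, one_smul, smul_zero, mul_zero, zero_mul, one_mul, add_zero, zero_add, sub_zero,
      zero_sub, hb.map_neg_left, map_neg, sub_self] at hxyz hadj hopp
    refine ⟨fun x y z => ?_, fun x y => ?_, fun x y => ?_, fun x y => ?_, fun x y => ?_,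
      fun x y z => ?_⟩
    · linear_combination (norm := module) (hxyz x y z).1
    · linear_combination (norm := module) (hadj x y).1
    · linear_combination -(hadj x y).2
    · linear_combination (norm := module) -(hopp x y).1
    · linear_combination -(hopp x y).2
    · linear_combination (hxyz x y z).2
  · rintro ⟨T1, T2, T3, T4, T5, T6⟩ ⟨x, a⟩ ⟨y, b⟩ ⟨z, c⟩ ⟨t, d⟩
    have hzx := ha z x
    have hty := ha t y
    have T1b := T1 z t x
    have T1c := T1 t x y
    have T6b := T6 z t x
    have T6c := T6 t x y
    simp only [hzx, hty, hb.map_neg_left, map_neg] at T1b T1c T6b T6c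
    have hM := hS x y z t
    simp only [sagleF] at hM
    ext
    · simp only [sagleF, flagBracket, Prod.fst_add, Prod.fst_sub, Prod.fst_zero, hal, hsl, har, hsr, hb.map_sub_left, hb.map_sub_right,
        map_add, map_sub, map_smul, smul_eq_mul, ha (D z) (bm y t), ha (D x) (bm y t),
        ha (D z) (D y), ha (D x) (D t)]
      linear_combination (norm := module) hM + d • T1 x y z + a • T1 y z t + b • T1b
        + c • T1c
        + (c * d) • T2 x y + (d * a) • T2 y z + (a * b) • T2 z t + (b * c) • T2 t x
        - (b * d) • T4 x z - (a * c) • T4 y t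
    · simp only [sagleF, flagBracket, Prod.snd_add, Prod.snd_sub, Prod.snd_zero, hal, hsl,
        hb.map_sub_left, map_add, map_sub, map_smul, smul_eq_mul]
      linear_combination d * T6 x y z + a * T6 y z t + b * T6b + c * T6c
        - (c * d) * T3 x y - (d * a) * T3 y z - (a * b) * T3 z t - (b * c) * T3 t x
        - (b * d) * T5 x z - (a * c) * T5 y t
end
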